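/- arXiv:1611.04198 — 2 statements merged into one kernel-verified Lean document; each statement's English description precedes it below -/
import Mathlib

section
/- First representation of the Cauchy–Jost function (Theorem 1, Eq. (new10)): if f is a Cauchy–Jost function for the data (κ, C, C', e), then for every λ ∈ ℂ with λ ∉ {κ_1,…,κ_N} and every μ ∈ ℂ with μ ∉ {λ, κ_1,…,κ_N}, f(λ,μ) = R(μ)/(μ−λ) − R(μ) ∑_{j=1}^{N_a} λ^{j−1} ∑_{m=1}^{N} ((C' E^{−1} V')^{−1} C' E^{−1})_{j,m} / (μ − κ_m). -/
open Finset Matrix Polynomial Filter Topology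

noncomputable section

/-- `rProd κ n = ∏_{m ≠ n} (κ n - κ m)`. -/
def rProd {N : ℕ} (κ : Fin N → ℝ) (n : Fin N) : ℝ :=
  ∏ m ∈ Finset.univ.erase n, (κ n - κ m)

/-- `Rpoly κ z = ∏_{n=1}^N (z - κ n)`. -/
def Rpoly {N : ℕ} (κ : Fin N → ℝ) (z : ℂ) : ℂ :=
  ∏ n, (z - (κ n : ℂ))

/-- The incomplete Vandermonde matrix `V`, of size `N_b × N`. -/
def Vmat (Na Nb : ℕ) (κ : Fin (Na + Nb) → ℝ) : Matrix (Fin Nb) (Fin (Na + Nb)) ℝ :=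
  Matrix.of fun i n => κ n ^ (i : ℕ)

/-- The incomplete Vandermonde matrix `V'`, of size `N × N_a`. -/
def Vmat' (Na Nb : ℕ) (κ : Fin (Na + Nb) → ℝ) : Matrix (Fin (Na + Nb)) (Fin Na) ℝ :=
  Matrix.of fun n j => κ n ^ (j : ℕ)

/-- `f` is a Cauchy–Jost function for the data `(κ, C, C', e)`:
(i) for every `λ` there is a polynomial `P_λ` of degree at most `N_b` with
`(λ-μ) f(λ,μ) = P_λ(μ)` for all `μ ≠ λ`; (ii) `P_λ(λ) = -R(λ)`;
(iii) `∑_m f(λ,κ_m) e_m C_{m,k} = 0` for `λ ∉ {κ_1,…,κ_N}` and all `k`. -/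
def IsCauchyJost {N Nb : ℕ} (κ : Fin N → ℝ) (C : Matrix (Fin N) (Fin Nb) ℝ)
    (e : Fin N → ℝ) (f : ℂ → ℂ → ℂ) : Prop :=
  (∀ lam : ℂ, ∃ P : Polynomial ℂ, P.degree ≤ (Nb : WithBot ℕ) ∧
      (∀ mu : ℂ, mu ≠ lam → (lam - mu) * f lam mu = P.eval mu) ∧
      P.eval lam = - Rpoly κ lam) ∧
  (∀ lam : ℂ, (∀ n, lam ≠ (κ n : ℂ)) →
      ∀ k : Fin Nb, (∑ m, f lam ((κ m : ℝ) : ℂ) * (e m : ℂ) * (C m k : ℂ)) = 0)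

/-- A row vector annihilated by `B` is a combination of the rows of `A`, provided `A * B = 0` and
the ranks of `A` and `B` are complementary. -/
theorem exists_vecMul_eq_of_vecMul_eq_zero {K m n p : Type*} [Field K] [Fintype m] [Fintype n]
    [Fintype p] (A : Matrix m n K) (B : Matrix n p K) (hAB : A * B = 0)
    (hrank : A.rank + B.rank = Fintype.card n) (x : n → K) (hx : x ᵥ* B = 0) :
    ∃ a : m → K, a ᵥ* A = x := by
  have hle : LinearMap.range Aᵀ.mulVecLin ≤ LinearMap.ker Bᵀ.mulVecLin := by
    rintro _ ⟨a, rfl⟩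
    simp [hAB]
  have hA : Module.finrank K (LinearMap.range Aᵀ.mulVecLin) = A.rank := A.rank_transpose
  have hB : Module.finrank K (LinearMap.range Bᵀ.mulVecLin) = B.rank := B.rank_transpose
  have hn := LinearMap.finrank_range_add_finrank_ker Bᵀ.mulVecLin
  rw [Module.finrank_fintype_fun_eq_card] at hn
  have heq := Submodule.eq_of_le_of_finrank_eq hle (by omega)
  have hmem : x ∈ LinearMap.range Aᵀ.mulVecLin := by
    rw [heq, LinearMap.mem_ker, Matrix.mulVecLin_apply, Matrix.mulVec_transpose, hx]
  obtain ⟨a, ha⟩ := hmem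
  exact ⟨a, by rwa [Matrix.mulVecLin_apply, Matrix.mulVec_transpose] at ha⟩

/-- Complex row vectors annihilated by a real matrix `B` are complex combinations of the rows of
`A`, provided `A * B = 0` and the ranks of `A` and `B` are complementary. -/
theorem exists_complex_vecMul_eq_of_vecMul_eq_zero {m n p : Type*} [Fintype m] [Fintype n]
    [Fintype p] (A : Matrix m n ℝ) (B : Matrix n p ℝ) (hAB : A * B = 0)
    (hrank : A.rank + B.rank = Fintype.card n) (x : n → ℂ)
    (hx : x ᵥ* B.map Complex.ofReal = 0) :
    ∃ a : m → ℂ, a ᵥ* A.map Complex.ofReal = x := by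
  obtain ⟨a, ha⟩ := exists_vecMul_eq_of_vecMul_eq_zero A B hAB hrank (fun i => (x i).re) (by
    ext k
    simpa [Matrix.vecMul, dotProduct] using congrArg Complex.re (congrFun hx k))
  obtain ⟨b, hb⟩ := exists_vecMul_eq_of_vecMul_eq_zero A B hAB hrank (fun i => (x i).im) (by
    ext k
    simpa [Matrix.vecMul, dotProduct] using congrArg Complex.im (congrFun hx k))
  refine ⟨fun i => ⟨a i, b i⟩, ?_⟩
  ext k
  apply Complex.ext
  · simpa [Matrix.vecMul, dotProduct] using congrFun ha k
  · simpa [Matrix.vecMul, dotProduct] using congrFun hb k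

theorem injective_option_elim {F ι : Type*} {v : ι → F} (hv : Function.Injective v) {x : F}
    (hx : ∀ i, x ≠ v i) : Function.Injective fun j : Option ι => Option.elim j x v := by
  rintro (_ | i) (_ | j) h
  · rfl
  · exact absurd h (hx j)
  · exact absurd h.symm (hx i)
  · exact congrArg some (hv h)

section NodesWithExtraPoint

variable {F ι : Type*} [Field F] [Fintype ι] [DecidableEq ι]

theorem prod_erase_none_elim_sub (v : ι → F) (x : F) :
    ∏ j ∈ Finset.univ.erase none, (x - Option.elim j x v) = ∏ j, (x - v j) := by
  have : (Finset.univ : Finset (Option ι)).erase none = Finset.univ.map Function.Embedding.some := by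
    ext j
    cases j <;> simp
  simp [this]

theorem prod_erase_some_elim_sub (v : ι → F) (x : F) (i : ι) :
    ∏ j ∈ Finset.univ.erase (some i), (v i - Option.elim j x v) =
      (v i - x) * ∏ j ∈ Finset.univ.erase i, (v i - v j) := by
  have : (Finset.univ : Finset (Option ι)).erase (some i) =
      Finset.insertNone (Finset.univ.erase i) := by
    ext j
    cases j <;> simp
  rw [this, Finset.prod_insertNone]
  rfl

/-- The divided difference over the nodes `x, v i` kills polynomials of degree below `card ι`. -/
theorem eval_div_prod_add_sum_eq_zero {v : ι → F} (hv : Function.Injective v) {x : F}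
    (hx : ∀ i, x ≠ v i) {P : F[X]} (hP : P.degree < Fintype.card ι) :
    P.eval x / ∏ j, (x - v j) +
      ∑ i, P.eval (v i) / ((v i - x) * ∏ j ∈ Finset.univ.erase i, (v i - v j)) = 0 := by
  have h := Lagrange.coeff_eq_sum (s := Finset.univ)
    (v := fun j : Option ι => Option.elim j x v)
    (injective_option_elim hv hx).injOn (P := P) (hP.trans (by
      rw [Finset.card_univ, Fintype.card_option]
      exact_mod_cast Nat.lt_succ_self _))
  rw [Finset.card_univ, Fintype.card_option, Nat.add_sub_cancel,
    Polynomial.coeff_eq_zero_of_degree_lt hP, Fintype.sum_option] at h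
  simp only [Option.elim_none, Option.elim_some, prod_erase_none_elim_sub,
    prod_erase_some_elim_sub] at h
  exact h.symm

/-- Partial fractions expansion of a polynomial of degree at most `card ι` over the nodes
`x, v i`. -/
theorem eval_eq_mul_partial_fractions {v : ι → F} (hv : Function.Injective v) {x : F}
    (hx : ∀ i, x ≠ v i) {P : F[X]} (hP : P.degree ≤ Fintype.card ι) {y : F} (hyx : y ≠ x)
    (hy : ∀ i, y ≠ v i) :
    P.eval y = (y - x) * (∏ j, (y - v j)) *
      ((∏ j, (x - v j))⁻¹ * (y - x)⁻¹ * P.eval x +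
        ∑ i, ((v i - x) * ∏ j ∈ Finset.univ.erase i, (v i - v j))⁻¹ * (y - v i)⁻¹ *
          P.eval (v i)) := by
  have hP' : P.degree < (Finset.univ : Finset (Option ι)).card := hP.trans_lt (by
    rw [Finset.card_univ, Fintype.card_option]
    exact_mod_cast Nat.lt_succ_self _)
  have h := congrArg (Polynomial.eval y) (Lagrange.eq_interpolate (s := Finset.univ)
    (v := fun j : Option ι => Option.elim j x v) (injective_option_elim hv hx).injOn hP')
  rw [Lagrange.eval_interpolate_not_at_node, Lagrange.eval_nodal, Fintype.prod_option,
    Fintype.sum_option] at h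
  · simp only [Lagrange.nodalWeight, Finset.prod_inv_distrib, Option.elim_none, Option.elim_some,
      prod_erase_none_elim_sub, prod_erase_some_elim_sub] at h
    exact h
  · rintro (_ | i) -
    · exact hyx
    · exact hy i

end NodesWithExtraPoint

theorem map_ofReal_mul {l m n : Type*} [Fintype m] (A : Matrix l m ℝ) (B : Matrix m n ℝ) :
    (A * B).map Complex.ofReal = A.map Complex.ofReal * B.map Complex.ofReal :=
  Matrix.map_mul (f := Complex.ofRealHom)

theorem rProd_ne_zero {N : ℕ} {κ : Fin N → ℝ} (hκ : Function.Injective κ) (n : Fin N) :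
    rProd κ n ≠ 0 :=
  Finset.prod_ne_zero_iff.mpr fun _ hm =>
    sub_ne_zero.mpr fun h => (Finset.mem_erase.mp hm).1 (hκ h).symm

/-- First representation of the Cauchy–Jost function (Theorem 1, Eq. (new10)). -/
theorem cauchyJost_first_representation
    (Na Nb : ℕ) (hNa : 1 ≤ Na) (hNb : 1 ≤ Nb)
    (κ : Fin (Na + Nb) → ℝ) (hκ : StrictMono κ)
    (C : Matrix (Fin (Na + Nb)) (Fin Nb) ℝ) (hC : C.rank = Nb)
    (C' : Matrix (Fin Na) (Fin (Na + Nb)) ℝ) (hC' : C'.rank = Na)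
    (horth : C' * Matrix.diagonal (rProd κ) * C = 0)
    (e : Fin (Na + Nb) → ℝ) (he : ∀ n, 0 < e n)
    (hdet : (C' * Matrix.diagonal (fun n => (e n)⁻¹) * Vmat' Na Nb κ).det ≠ 0)
    (f : ℂ → ℂ → ℂ) (hf : IsCauchyJost κ C e f)
    :
    ∀ lam : ℂ, (∀ n, lam ≠ (κ n : ℂ)) →
      ∀ mu : ℂ, mu ≠ lam → (∀ n, mu ≠ (κ n : ℂ)) →
        f lam mu =
          Rpoly κ mu / (mu - lam) -
            Rpoly κ mu * ∑ j : Fin Na, lam ^ (j : ℕ) *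
              ∑ m : Fin (Na + Nb),
                ((((C' * Matrix.diagonal (fun n => (e n)⁻¹) * Vmat' Na Nb κ)⁻¹ * C' *
                    Matrix.diagonal (fun n => (e n)⁻¹)) j m : ℝ) : ℂ) / (mu - (κ m : ℂ)) := by
  intro lam hlam mu hmu hmuκ
  obtain ⟨hpoly, hsum⟩ := hf
  obtain ⟨P, hPdeg, hPf, hPlam⟩ := hpoly lam
  have hv : Function.Injective fun n => (κ n : ℂ) := Complex.ofReal_injective.comp hκ.injective
  have hr : ∀ n, (rProd κ n : ℂ) ≠ 0 := fun n =>
    Complex.ofReal_ne_zero.mpr (rProd_ne_zero hκ.injective n)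
  have hr' : ∀ n, ∏ j ∈ Finset.univ.erase n, ((κ n : ℂ) - (κ j : ℂ)) = (rProd κ n : ℂ) := by
    intro n
    simp [rProd]
  have hR : ∏ j, (lam - (κ j : ℂ)) ≠ 0 :=
    Finset.prod_ne_zero_iff.mpr fun n _ => sub_ne_zero.mpr (hlam n)
  have hPκ : ∀ m, P.eval (κ m : ℂ) = (lam - κ m) * f lam (κ m) := fun m =>
    (hPf _ (hlam m).symm).symm
  set D : Matrix (Fin (Na + Nb)) (Fin (Na + Nb)) ℝ :=
    Matrix.diagonal (fun n => (e n)⁻¹) with hD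
  set M := C' * D * Vmat' Na Nb κ with hM
  -- the residues of `f lam · / R` at the points `κ m`
  let g : Fin (Na + Nb) → ℂ := fun m => f lam (κ m) / rProd κ m
  obtain ⟨a, ha⟩ := exists_complex_vecMul_eq_of_vecMul_eq_zero C'
    (Matrix.diagonal (rProd κ) * C) (by rw [← Matrix.mul_assoc, horth])
    (by
      rw [Matrix.rank_mul_eq_right_of_det_ne_zero, hC, hC', Fintype.card_fin]
      rw [Matrix.det_diagonal]
      exact Finset.prod_ne_zero_iff.mpr fun n _ => rProd_ne_zero hκ.injective n)
    (fun m => g m * e m) (by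
      ext k
      rw [Pi.zero_apply, ← hsum lam hlam k]
      rw [Matrix.vecMul, dotProduct]
      refine Finset.sum_congr rfl fun m _ => ?_
      have := hr m
      simp only [Matrix.map_apply, Matrix.diagonal_mul, g]
      push_cast
      field_simp)
  have hg : a ᵥ* (C' * D).map Complex.ofReal = g := by
    ext m
    have hem : (e m : ℂ) ≠ 0 := Complex.ofReal_ne_zero.mpr (he m).ne'
    rw [map_ofReal_mul, ← Matrix.vecMul_vecMul, ha, hD, Matrix.diagonal_map Complex.ofReal_zero,
      Matrix.vecMul_diagonal]
    push_cast
    field_simp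
  have hmom : g ᵥ* (Vmat' Na Nb κ).map Complex.ofReal = fun j : Fin Na => -lam ^ (j : ℕ) := by
    ext j
    have hdeg : (P * X ^ (j : ℕ)).degree < (Fintype.card (Fin (Na + Nb)) : WithBot ℕ) := by
      rw [Polynomial.degree_mul, Polynomial.degree_X_pow, Fintype.card_fin]
      refine (add_le_add hPdeg le_rfl).trans_lt ?_
      exact_mod_cast (by omega : Nb + (j : ℕ) < Na + Nb)
    have h := eval_div_prod_add_sum_eq_zero hv hlam hdeg
    simp only [Polynomial.eval_mul, Polynomial.eval_pow, Polynomial.eval_X, hPlam, hPκ, hr',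
      Rpoly] at h
    have hterm : ∀ m, (lam - (κ m : ℂ)) * f lam (κ m) * (κ m : ℂ) ^ (j : ℕ) /
        (((κ m : ℂ) - lam) * rProd κ m) = -(g m * (κ m : ℂ) ^ (j : ℕ)) := by
      intro m
      have h1 := hr m
      have h2 : (κ m : ℂ) - lam ≠ 0 := sub_ne_zero.mpr (hlam m).symm
      simp only [g]
      field_simp
      ring
    simp only [hterm, Finset.sum_neg_distrib] at h
    rw [neg_mul, neg_div, mul_div_cancel_left₀ _ hR] at h
    have hgsum : (g ᵥ* (Vmat' Na Nb κ).map Complex.ofReal) j =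
        ∑ m, g m * (κ m : ℂ) ^ (j : ℕ) := by
      simp [Matrix.vecMul, dotProduct, Vmat']
    rw [hgsum]
    linear_combination -h
  have haM : a = (fun j : Fin Na => -lam ^ (j : ℕ)) ᵥ* M⁻¹.map Complex.ofReal := by
    rw [← hmom, ← hg, Matrix.vecMul_vecMul, Matrix.vecMul_vecMul, ← map_ofReal_mul,
      ← map_ofReal_mul, ← Matrix.mul_assoc, ← hM, Matrix.mul_nonsing_inv _ hdet.isUnit,
      Matrix.map_one _ Complex.ofReal_zero Complex.ofReal_one, Matrix.vecMul_one]
  have hgM : ∀ m, g m = -∑ j : Fin Na, lam ^ (j : ℕ) * ((M⁻¹ * C' * D) j m : ℂ) := by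
    intro m
    rw [← hg, haM, Matrix.vecMul_vecMul, ← map_ofReal_mul, ← Matrix.mul_assoc]
    simp [Matrix.vecMul, dotProduct]
  have hpf := eval_eq_mul_partial_fractions hv hlam (P := P) (hPdeg.trans (by
    rw [Fintype.card_fin]; exact_mod_cast Nat.le_add_left _ _)) hmu hmuκ
  have hterm : ∀ m, (((κ m : ℂ) - lam) * rProd κ m)⁻¹ * (mu - (κ m : ℂ))⁻¹ *
      ((lam - (κ m : ℂ)) * f lam (κ m)) = -(g m / (mu - κ m)) := by
    intro m
    have h1 := hr m
    have h2 : (κ m : ℂ) - lam ≠ 0 := sub_ne_zero.mpr (hlam m).symm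
    have h3 : mu - (κ m : ℂ) ≠ 0 := sub_ne_zero.mpr (hmuκ m)
    simp only [g]
    field_simp
    ring
  have hswap : ∑ m, g m / (mu - κ m) = -∑ j : Fin Na, lam ^ (j : ℕ) *
      ∑ m, ((M⁻¹ * C' * D) j m : ℂ) / (mu - κ m) := by
    simp only [hgM, neg_div, Finset.sum_neg_distrib, Finset.sum_div, Finset.mul_sum]
    rw [Finset.sum_comm]
    simp only [mul_div_assoc]
  simp only [hr', hPκ, hterm, hPlam, Finset.sum_neg_distrib, hswap, neg_neg] at hpf
  have h0 : mu - lam ≠ 0 := sub_ne_zero.mpr hmu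
  have hfeq : f lam mu = -P.eval mu / (mu - lam) := by
    rw [← hPf mu hmu]
    field_simp
    ring
  rw [hfeq, hpf]
  simp only [Rpoly]
  field_simp
  ring

end
end

section
/- B-type Darboux transformation (Section 5 Theorem, B-transformation, Eqs. (o-66)–(o45), (o-11)): let f be a Cauchy–Jost function for the data (κ, C, C', e). Let κ_{N+1} ∈ ℝ with κ_{N+1} ∉ {κ_1,…,κ_N}; set R̃(λ) = (λ−κ_{N+1}) R(λ), r̃_m = (κ_m − κ_{N+1}) r_m for m = 1,…,N, and r̃_{N+1} = R(κ_{N+1}). Let β_1,…,β_{N+1} ∈ ℝ with β_{N+1} ≠ 0 and Δ := ∑_{m=1}^N (β_m/r_m) f(κ_{N+1}, κ_m) + β_{N+1} ≠ 0. For λ ∉ {κ_1,…,κ_N} write T(λ) := ∑_{m=1}^N (β_m/r_m) f(λ,κ_m); for such λ and μ ∉ {λ, κ_{N+1}} define f̃(λ,μ) = (μ−κ_{N+1}) [ f(λ,μ) − f(κ_{N+1},μ) · T(λ) / Δ ]; define f̃(λ,κ_m) := (κ_m−κ_{N+1}) [ f(λ,κ_m) − f(κ_{N+1},κ_m) T(λ)/Δ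 ] for m = 1,…,N, and f̃(λ,κ_{N+1}) := −R(κ_{N+1}) T(λ)/Δ. Then: (a) for every λ ∉ {κ_1,…,κ_N} there is a polynomial P̃_λ ∈ ℂ[X] of degree at most N_b+1 with (λ−μ) f̃(λ,μ) = P̃_λ(μ) for all μ ≠ λ with μ ∉ {κ_{N+1}} (and also at μ = κ_{N+1} with the value f̃(λ,κ_{N+1})), and P̃_λ(λ) = −R̃(λ); (b) for every μ ∉ {κ_1,…,κ_{N+1}} there is a polynomial Q̃_μ ∈ ℂ[X] of degree at most N_a with (λ−μ) f̃(λ,μ) = Q̃_μ(λ) for all λ ∉ {μ, κ_1,…,κ_N}, and Q̃_μ(μ) = −R̃(μ); (c) ∑_{m=1}^N f̃(λ,κ_m) e_m (r_m/r̃_m) C_{m,k} = 0 for every k = 1,…,N_b and every λ ∉ {κ_1,…,κ_N}; (d) ∑_{m=1}^{N+1} (β_m/r̃_m) f̃(λ,κ_m) = 0 for every λ ∉ {κ_1,…,κ_N}. -/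
open Finset Matrix Polynomial Filter Topology

noncomputable section

/-- Two matrices over a field with `D * C = 0` and complementary ranks: every row vector
annihilated by `C` is a combination of the rows of `D`. -/
theorem exists_vecMul_eq_of_mul_eq_zero {K : Type*} [Field K] {p q n : ℕ} (hn : n = p + q)
    (D : Matrix (Fin p) (Fin n) K) (C : Matrix (Fin n) (Fin q) K)
    (hD : D.rank = p) (hC : C.rank = q) (hDC : D * C = 0)
    (v : Fin n → K) (hv : v ᵥ* C = 0) : ∃ a : Fin p → K, a ᵥ* D = v := by
  have hle : LinearMap.range D.vecMulLinear ≤ LinearMap.ker C.vecMulLinear := by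
    rintro _ ⟨a, rfl⟩
    simp [Matrix.vecMul_vecMul, hDC]
  have hrD : Module.finrank K (LinearMap.range D.vecMulLinear) = p := by
    have h := Matrix.rank_transpose D
    rwa [hD, Matrix.rank, Matrix.mulVecLin_transpose] at h
  have hrC : Module.finrank K (LinearMap.range C.vecMulLinear) = q := by
    have h := Matrix.rank_transpose C
    rwa [hC, Matrix.rank, Matrix.mulVecLin_transpose] at h
  have hsum := LinearMap.finrank_range_add_finrank_ker C.vecMulLinear
  rw [hrC, Module.finrank_fin_fun] at hsum
  have heq := Submodule.eq_of_le_of_finrank_eq hle (by omega)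
  have hmem : v ∈ LinearMap.ker C.vecMulLinear := by simpa using hv
  rw [← heq] at hmem
  exact hmem

/-- Complex row vectors annihilated by a real matrix `C` are complex combinations of the rows of
a real matrix `D` with `D * C = 0` and complementary rank. -/
theorem exists_complex_comb_of_mul_eq_zero {p q n : ℕ} (hn : n = p + q)
    (D : Matrix (Fin p) (Fin n) ℝ) (C : Matrix (Fin n) (Fin q) ℝ)
    (hD : D.rank = p) (hC : C.rank = q) (hDC : D * C = 0)
    (v : Fin n → ℂ) (hv : ∀ k, ∑ m, v m * (C m k : ℂ) = 0) :
    ∃ a : Fin p → ℂ, ∀ m, v m = ∑ i, a i * (D i m : ℂ) := by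
  obtain ⟨x, hx⟩ := exists_vecMul_eq_of_mul_eq_zero hn D C hD hC hDC (fun m => (v m).re) (by
    ext k
    simpa [Matrix.vecMul, dotProduct] using congrArg Complex.re (hv k))
  obtain ⟨y, hy⟩ := exists_vecMul_eq_of_mul_eq_zero hn D C hD hC hDC (fun m => (v m).im) (by
    ext k
    simpa [Matrix.vecMul, dotProduct] using congrArg Complex.im (hv k))
  refine ⟨fun i => ⟨x i, y i⟩, fun m => ?_⟩
  apply Complex.ext
  · simpa [Matrix.vecMul, dotProduct] using (congrFun hx m).symm
  · simpa [Matrix.vecMul, dotProduct] using (congrFun hy m).symm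

/-- Lagrange interpolation at the nodes `κ`, evaluated off the nodes. -/
theorem eval_eq_Rpoly_mul_sum {N : ℕ} (κ : Fin N → ℝ) (hκ : Function.Injective κ)
    (p : ℂ[X]) (hp : p.degree < (N : WithBot ℕ)) (x : ℂ) (hx : ∀ n, x ≠ (κ n : ℂ)) :
    p.eval x =
      Rpoly κ x * ∑ m, ((rProd κ m : ℝ) : ℂ)⁻¹ * (x - (κ m : ℂ))⁻¹ * p.eval (κ m : ℂ) := by
  have hinj : Set.InjOn (fun n => (κ n : ℂ)) (Finset.univ : Finset (Fin N)) :=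
    (Complex.ofReal_injective.comp hκ).injOn
  have h := Lagrange.eq_interpolate (f := p) hinj (by simpa using hp)
  conv_lhs => rw [h]
  rw [Lagrange.eval_interpolate_not_at_node _ (fun i _ => hx i), Lagrange.eval_nodal]
  simp only [Rpoly, Lagrange.nodalWeight, rProd, Complex.ofReal_prod, Complex.ofReal_sub,
    Finset.prod_inv_distrib]

theorem Rpoly_ne_zero {N : ℕ} (κ : Fin N → ℝ) {x : ℂ} (hx : ∀ n, x ≠ (κ n : ℂ)) :
    Rpoly κ x ≠ 0 :=
  Finset.prod_ne_zero_iff.mpr fun n _ => sub_ne_zero.mpr (hx n)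

/-- The moments of a Cauchy–Jost function at the nodes. -/
theorem IsCauchyJost.sum_pow_mul {Na Nb : ℕ} {κ : Fin (Na + Nb) → ℝ}
    (hκ : Function.Injective κ) {C : Matrix (Fin (Na + Nb)) (Fin Nb) ℝ}
    {e : Fin (Na + Nb) → ℝ} {f : ℂ → ℂ → ℂ} (hf : IsCauchyJost κ C e f)
    {lam : ℂ} (hlam : ∀ n, lam ≠ (κ n : ℂ)) (j : Fin Na) :
    ∑ m, (κ m : ℂ) ^ (j : ℕ) * (((rProd κ m : ℝ) : ℂ)⁻¹ * f lam (κ m : ℂ)) =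
      -lam ^ (j : ℕ) := by
  obtain ⟨P, hPdeg, hP, hPlam⟩ := hf.1 lam
  have hR := Rpoly_ne_zero κ hlam
  have hdeg : (X ^ (j : ℕ) * P).degree < ((Na + Nb : ℕ) : WithBot ℕ) := by
    rw [Polynomial.degree_lt_iff_coeff_zero]
    intro k hk
    have := j.2
    rw [Polynomial.coeff_X_pow_mul', if_pos (by omega)]
    exact Polynomial.coeff_eq_zero_of_degree_lt
      (lt_of_le_of_lt hPdeg (by exact_mod_cast (by omega : Nb < k - j)))
  have h := eval_eq_Rpoly_mul_sum κ hκ _ hdeg lam hlam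
  simp only [Polynomial.eval_mul, Polynomial.eval_pow, Polynomial.eval_X, hPlam] at h
  have h2 : Rpoly κ lam * (∑ m, (κ m : ℂ) ^ (j : ℕ) *
      (((rProd κ m : ℝ) : ℂ)⁻¹ * f lam (κ m : ℂ))) = Rpoly κ lam * (-lam ^ (j : ℕ)) := by
    rw [mul_neg, mul_comm _ (lam ^ (j : ℕ)), ← mul_neg, h]
    congr 1
    refine Finset.sum_congr rfl fun m _ => ?_
    rw [← hP _ (hlam m).symm]
    have := sub_ne_zero.mpr (hlam m)
    field_simp
  exact mul_left_cancel₀ hR h2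

/-- At the nodes `μ = κ m`, a Cauchy–Jost function is a polynomial in `λ` of degree at most
`Na - 1`. -/
theorem IsCauchyJost.exists_polynomial_at_node {Na Nb : ℕ} {κ : Fin (Na + Nb) → ℝ}
    (hκ : Function.Injective κ) {C : Matrix (Fin (Na + Nb)) (Fin Nb) ℝ} (hC : C.rank = Nb)
    {C' : Matrix (Fin Na) (Fin (Na + Nb)) ℝ} (hC' : C'.rank = Na)
    (horth : C' * Matrix.diagonal (rProd κ) * C = 0)
    {e : Fin (Na + Nb) → ℝ} (he : ∀ n, e n ≠ 0)
    (hdet : (C' * Matrix.diagonal (fun n => (e n)⁻¹) * Vmat' Na Nb κ).det ≠ 0)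
    {f : ℂ → ℂ → ℂ} (hf : IsCauchyJost κ C e f) (m : Fin (Na + Nb)) :
    ∃ A : ℂ[X], A.natDegree ≤ Na - 1 ∧
      ∀ lam : ℂ, (∀ n, lam ≠ (κ n : ℂ)) → f lam (κ m : ℂ) = A.eval lam := by
  set M := C' * Matrix.diagonal (fun n => (e n)⁻¹) * Vmat' Na Nb κ with hM
  have hrank : (C' * Matrix.diagonal (rProd κ)).rank = Na := by
    rw [Matrix.rank_mul_eq_left_of_isUnit_det, hC']
    rw [Matrix.det_diagonal, isUnit_iff_ne_zero]
    exact Finset.prod_ne_zero_iff.mpr fun n _ => rProd_ne_zero hκ n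
  have hMij : ∀ i j, ((M i j : ℝ) : ℂ) =
      ∑ n, (C' i n : ℂ) * (e n : ℂ)⁻¹ * (κ n : ℂ) ^ (j : ℕ) := by
    intro i j
    rw [hM, Matrix.mul_apply]
    simp [Vmat', Matrix.mul_diagonal]
  have hinv : ∀ i l, ∑ j, ((M i j : ℝ) : ℂ) * ((M⁻¹ j l : ℝ) : ℂ) = if i = l then 1 else 0 := by
    intro i l
    have h := congrFun (congrFun (Matrix.mul_nonsing_inv M (isUnit_iff_ne_zero.mpr hdet)) i) l
    rw [Matrix.mul_apply, Matrix.one_apply] at h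
    simp only [← Complex.ofReal_mul, ← Complex.ofReal_sum, h]
    split_ifs <;> simp
  refine ⟨∑ j : Fin Na, Polynomial.C (∑ i, -((M⁻¹ j i : ℝ) : ℂ) *
    ((C' i m : ℂ) * ((rProd κ m : ℝ) : ℂ) * (e m : ℂ)⁻¹)) * X ^ (j : ℕ),
    Polynomial.natDegree_sum_le_of_forall_le _ _ fun j _ =>
      (Polynomial.natDegree_C_mul_X_pow_le _ _).trans (by omega), fun lam hlam => ?_⟩
  obtain ⟨a, ha⟩ := exists_complex_comb_of_mul_eq_zero rfl (C' * Matrix.diagonal (rProd κ)) C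
    hrank hC horth (fun n => f lam (κ n : ℂ) * (e n : ℂ)) (hf.2 lam hlam)
  have hfa : ∀ n, f lam (κ n : ℂ) =
      ∑ i, a i * ((C' i n : ℂ) * ((rProd κ n : ℝ) : ℂ) * (e n : ℂ)⁻¹) := by
    intro n
    have hen : (e n : ℂ) ≠ 0 := by exact_mod_cast he n
    have h := ha n
    simp only [Matrix.mul_diagonal, Complex.ofReal_mul] at h
    rw [← mul_div_cancel_right₀ (f lam (κ n : ℂ)) hen, h, div_eq_mul_inv, Finset.sum_mul]
    exact Finset.sum_congr rfl fun i _ => by ring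
  have haM : ∀ j : Fin Na, ∑ i, a i * ((M i j : ℝ) : ℂ) = -lam ^ (j : ℕ) := by
    intro j
    rw [← hf.sum_pow_mul hκ hlam j]
    simp only [hMij, hfa, Finset.mul_sum]
    rw [Finset.sum_comm]
    refine Finset.sum_congr rfl fun n _ => Finset.sum_congr rfl fun i _ => ?_
    have hr : ((rProd κ n : ℝ) : ℂ) ≠ 0 := by exact_mod_cast rProd_ne_zero hκ n
    field_simp
  have hal : ∀ l, a l = ∑ j : Fin Na, -lam ^ (j : ℕ) * ((M⁻¹ j l : ℝ) : ℂ) := by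
    intro l
    simp only [← haM, Finset.sum_mul]
    rw [Finset.sum_comm]
    simp only [mul_assoc, ← Finset.mul_sum, hinv]
    simp
  rw [hfa, Polynomial.eval_finsetSum]
  simp only [hal, Polynomial.eval_mul, Polynomial.eval_C, Polynomial.eval_pow,
    Polynomial.eval_X, Finset.sum_mul]
  rw [Finset.sum_comm]
  exact Finset.sum_congr rfl fun j _ => Finset.sum_congr rfl fun i _ => by ring

/-- Off the nodes, `(λ - μ) f(λ, μ)` is a polynomial in `λ` of degree at most `Na`. -/
theorem IsCauchyJost.exists_dual_polynomial {Na Nb : ℕ} (hNa : 1 ≤ Na)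
    {κ : Fin (Na + Nb) → ℝ} (hκ : Function.Injective κ)
    {C : Matrix (Fin (Na + Nb)) (Fin Nb) ℝ} {e : Fin (Na + Nb) → ℝ}
    {f : ℂ → ℂ → ℂ} (hf : IsCauchyJost κ C e f) (A : Fin (Na + Nb) → ℂ[X])
    (hAdeg : ∀ m, (A m).natDegree ≤ Na - 1)
    (hA : ∀ m lam, (∀ n, lam ≠ (κ n : ℂ)) → f lam (κ m : ℂ) = (A m).eval lam)
    {mu : ℂ} (hmu : ∀ n, mu ≠ (κ n : ℂ)) :
    ∃ Q : ℂ[X], Q.degree ≤ (Na : WithBot ℕ) ∧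
      (∀ lam : ℂ, lam ≠ mu → (∀ n, lam ≠ (κ n : ℂ)) → (lam - mu) * f lam mu = Q.eval lam) ∧
      Q.eval mu = -Rpoly κ mu := by
  let Q : ℂ[X] := ∑ m, Polynomial.C (Rpoly κ mu * (((rProd κ m : ℝ) : ℂ)⁻¹ *
    (mu - (κ m : ℂ))⁻¹)) * ((X - Polynomial.C (κ m : ℂ)) * A m)
  have hQ : ∀ (lam : ℂ) (P : ℂ[X]), (∀ n, lam ≠ (κ n : ℂ)) → P.degree ≤ (Nb : WithBot ℕ) →
      (∀ mu : ℂ, mu ≠ lam → (lam - mu) * f lam mu = P.eval mu) → P.eval mu = Q.eval lam := by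
    intro lam P hlam hPdeg hP
    rw [eval_eq_Rpoly_mul_sum κ hκ P
      (lt_of_le_of_lt hPdeg (by exact_mod_cast (by omega : Nb < Na + Nb))) mu hmu]
    simp only [Q, Polynomial.eval_finsetSum, Polynomial.eval_mul, Polynomial.eval_C,
      Polynomial.eval_sub, Polynomial.eval_X, Finset.mul_sum]
    refine Finset.sum_congr rfl fun m _ => ?_
    rw [← hP _ (hlam m).symm, hA m lam hlam]
    ring
  refine ⟨Q, ?_, fun lam hne hlam => ?_, ?_⟩
  · rw [← Polynomial.natDegree_le_iff_degree_le]
    refine Polynomial.natDegree_sum_le_of_forall_le _ _ fun m _ => ?_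
    have h1 := hAdeg m
    have h2 : (X - Polynomial.C (κ m : ℂ)).natDegree = 1 := Polynomial.natDegree_X_sub_C _
    refine (Polynomial.natDegree_C_mul_le _ _).trans (Polynomial.natDegree_mul_le.trans ?_)
    omega
  · obtain ⟨P, hPdeg, hP, -⟩ := hf.1 lam
    rw [hP mu hne.symm, hQ lam P hlam hPdeg hP]
  · obtain ⟨P, hPdeg, hP, hPmu⟩ := hf.1 mu
    rw [← hQ mu P hmu hPdeg hP, hPmu]

/-- B-type Darboux transformation (Section 5 Theorem, B-transformation,
Eqs. (o-66)–(o45), (o-11)). -/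
theorem darboux_B_transformation
    (Na Nb : ℕ) (hNa : 1 ≤ Na) (hNb : 1 ≤ Nb)
    (κ : Fin (Na + Nb) → ℝ) (hκ : StrictMono κ)
    (C : Matrix (Fin (Na + Nb)) (Fin Nb) ℝ) (hC : C.rank = Nb)
    (C' : Matrix (Fin Na) (Fin (Na + Nb)) ℝ) (hC' : C'.rank = Na)
    (horth : C' * Matrix.diagonal (rProd κ) * C = 0)
    (e : Fin (Na + Nb) → ℝ) (he : ∀ n, 0 < e n)
    (hdet : (C' * Matrix.diagonal (fun n => (e n)⁻¹) * Vmat' Na Nb κ).det ≠ 0)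
    (f : ℂ → ℂ → ℂ) (hf : IsCauchyJost κ C e f)
    (κN1 : ℝ) (hκN1 : ∀ n, κN1 ≠ κ n)
    (b : Fin (Na + Nb) → ℝ) (bN1 : ℝ) (hbN1 : bN1 ≠ 0)
    (T : ℂ → ℂ)
    (hT : ∀ lam : ℂ, T lam = ∑ m, ((b m / rProd κ m : ℝ) : ℂ) * f lam ((κ m : ℝ) : ℂ))
    (hΔ : T ((κN1 : ℝ) : ℂ) + (bN1 : ℂ) ≠ 0)
    (ftil : ℂ → ℂ → ℂ)
    (hft1 : ∀ lam mu : ℂ, (∀ n, lam ≠ (κ n : ℂ)) → mu ≠ lam → mu ≠ ((κN1 : ℝ) : ℂ) →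
      ftil lam mu = (mu - ((κN1 : ℝ) : ℂ)) *
        (f lam mu - f ((κN1 : ℝ) : ℂ) mu * T lam / (T ((κN1 : ℝ) : ℂ) + (bN1 : ℂ))))
    (hft2 : ∀ lam : ℂ, (∀ n, lam ≠ (κ n : ℂ)) →
      ftil lam ((κN1 : ℝ) : ℂ) =
        -((((∏ n, (κN1 - κ n)) : ℝ) : ℂ) * T lam / (T ((κN1 : ℝ) : ℂ) + (bN1 : ℂ)))) :
    (∀ lam : ℂ, (∀ n, lam ≠ (κ n : ℂ)) →
      ∃ P : Polynomial ℂ, P.degree ≤ ((Nb + 1 : ℕ) : WithBot ℕ) ∧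
        (∀ mu : ℂ, mu ≠ lam → (lam - mu) * ftil lam mu = P.eval mu) ∧
        P.eval lam = -((lam - ((κN1 : ℝ) : ℂ)) * Rpoly κ lam)) ∧
    (∀ mu : ℂ, (∀ n, mu ≠ (κ n : ℂ)) → mu ≠ ((κN1 : ℝ) : ℂ) →
      ∃ Q : Polynomial ℂ, Q.degree ≤ (Na : WithBot ℕ) ∧
        (∀ lam : ℂ, lam ≠ mu → (∀ n, lam ≠ (κ n : ℂ)) →
          (lam - mu) * ftil lam mu = Q.eval lam) ∧
        Q.eval mu = -((mu - ((κN1 : ℝ) : ℂ)) * Rpoly κ mu)) ∧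
    (∀ k : Fin Nb, ∀ lam : ℂ, (∀ n, lam ≠ (κ n : ℂ)) →
      (∑ m, ftil lam ((κ m : ℝ) : ℂ) * (e m : ℂ) *
        ((rProd κ m / ((κ m - κN1) * rProd κ m) : ℝ) : ℂ) * (C m k : ℂ)) = 0) ∧
    (∀ lam : ℂ, (∀ n, lam ≠ (κ n : ℂ)) →
      (∑ m, ((b m / ((κ m - κN1) * rProd κ m) : ℝ) : ℂ) * ftil lam ((κ m : ℝ) : ℂ)) +
        ((bN1 / (∏ n, (κN1 - κ n)) : ℝ) : ℂ) * ftil lam ((κN1 : ℝ) : ℂ) = 0) := by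
  have hinj := hκ.injective
  have hκc : ∀ n, ((κN1 : ℝ) : ℂ) ≠ (κ n : ℂ) := fun n => by exact_mod_cast hκN1 n
  have hr : ∀ n, ((rProd κ n : ℝ) : ℂ) ≠ 0 := fun n => by exact_mod_cast rProd_ne_zero hinj n
  have hRc : ((∏ n, (κN1 - κ n) : ℝ) : ℂ) = Rpoly κ (κN1 : ℂ) := by simp [Rpoly]
  have hR1 := Rpoly_ne_zero κ hκc
  choose A hAdeg hA using
    hf.exists_polynomial_at_node hinj hC hC' horth (fun n => (he n).ne') hdet
  obtain ⟨Δ, hΔdef⟩ : ∃ Δ, Δ = T ((κN1 : ℝ) : ℂ) + (bN1 : ℂ) := ⟨_, rfl⟩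
  simp only [← hΔdef] at hΔ hft1 hft2
  refine ⟨fun lam hlam => ?_, fun mu hmu hmu1 => ?_, fun k lam hlam => ?_, fun lam hlam => ?_⟩
  · obtain ⟨P, hPdeg, hP, hPlam⟩ := hf.1 lam
    obtain ⟨S, hSdeg, hS, hS1⟩ := hf.1 (κN1 : ℂ)
    refine ⟨(X - Polynomial.C (κN1 : ℂ)) * P +
      (Polynomial.C lam - X) * (Polynomial.C (T lam / Δ) * S), ?_, fun mu hmu => ?_, ?_⟩
    · rw [← Polynomial.natDegree_le_iff_degree_le] at hPdeg hSdeg ⊢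
      compute_degree
      all_goals omega
    · simp only [Polynomial.eval_add, Polynomial.eval_mul, Polynomial.eval_sub,
        Polynomial.eval_X, Polynomial.eval_C]
      by_cases h1 : mu = (κN1 : ℂ)
      · rw [h1, hft2 lam hlam, hS1, hRc]
        ring
      · rw [hft1 lam mu hlam hmu h1, ← hP mu hmu, ← hS mu h1]
        ring
    · simp only [Polynomial.eval_add, Polynomial.eval_mul, Polynomial.eval_sub,
        Polynomial.eval_X, Polynomial.eval_C, hPlam]
      ring
  · obtain ⟨Q, hQdeg, hQ, hQmu⟩ := hf.exists_dual_polynomial hNa hinj A hAdeg hA hmu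
    let U : ℂ[X] := ∑ m, Polynomial.C ((b m / rProd κ m : ℝ) : ℂ) * A m
    have hU : ∀ lam, (∀ n, lam ≠ (κ n : ℂ)) → T lam = U.eval lam := by
      intro lam hlam
      simp only [hT, U, Polynomial.eval_finsetSum, Polynomial.eval_mul, Polynomial.eval_C]
      exact Finset.sum_congr rfl fun m _ => by rw [hA m lam hlam]
    have hUdeg : U.natDegree ≤ Na - 1 := by
      refine Polynomial.natDegree_sum_le_of_forall_le _ _ fun m _ => ?_
      exact (Polynomial.natDegree_C_mul_le _ _).trans (hAdeg m)
    refine ⟨Polynomial.C (mu - (κN1 : ℂ)) *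
      (Q - (X - Polynomial.C mu) * (Polynomial.C (f (κN1 : ℂ) mu / Δ) * U)), ?_,
      fun lam hne hlam => ?_, ?_⟩
    · rw [← Polynomial.natDegree_le_iff_degree_le] at hQdeg ⊢
      have h1 := Polynomial.natDegree_C_mul_le (f (κN1 : ℂ) mu / Δ) U
      have h2 : (X - Polynomial.C mu).natDegree = 1 := Polynomial.natDegree_X_sub_C _
      have h3 : ((X - Polynomial.C mu) *
          (Polynomial.C (f (κN1 : ℂ) mu / Δ) * U)).natDegree ≤ Na :=
        Polynomial.natDegree_mul_le.trans (by omega)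
      exact (Polynomial.natDegree_C_mul_le _ _).trans
        ((Polynomial.natDegree_sub_le _ _).trans (max_le hQdeg h3))
    · simp only [Polynomial.eval_mul, Polynomial.eval_sub, Polynomial.eval_X, Polynomial.eval_C]
      rw [hft1 lam mu hlam hne.symm hmu1, ← hQ lam hne hlam, ← hU lam hlam]
      ring
    · simp only [Polynomial.eval_mul, Polynomial.eval_sub, Polynomial.eval_X, Polynomial.eval_C,
        hQmu]
      ring
  · have h1 := hf.2 lam hlam k
    have h2 := hf.2 (κN1 : ℂ) hκc k
    calc _ = (∑ m, f lam (κ m : ℂ) * (e m : ℂ) * (C m k : ℂ)) -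
          T lam / Δ * ∑ m, f (κN1 : ℂ) (κ m : ℂ) * (e m : ℂ) * (C m k : ℂ) := by
          rw [Finset.mul_sum, ← Finset.sum_sub_distrib]
          refine Finset.sum_congr rfl fun m _ => ?_
          rw [hft1 lam _ hlam (hlam m).symm (hκc m).symm]
          have h3 : (κ m : ℂ) - (κN1 : ℂ) ≠ 0 := sub_ne_zero.mpr (hκc m).symm
          have h4 := hr m
          push_cast
          field_simp
      _ = 0 := by rw [h1, h2]; ring
  · have h1 : ∑ m, ((b m / ((κ m - κN1) * rProd κ m) : ℝ) : ℂ) * ftil lam (κ m : ℂ) =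
        T lam - T lam / Δ * T (κN1 : ℂ) := by
      obtain ⟨t, ht⟩ : ∃ t, t = T lam / Δ := ⟨_, rfl⟩
      rw [← ht, hT lam, hT (κN1 : ℂ), Finset.mul_sum, ← Finset.sum_sub_distrib]
      refine Finset.sum_congr rfl fun m _ => ?_
      rw [hft1 lam _ hlam (hlam m).symm (hκc m).symm, mul_div_assoc, ← ht]
      have h3 : (κ m : ℂ) - (κN1 : ℂ) ≠ 0 := sub_ne_zero.mpr (hκc m).symm
      have h4 := hr m
      push_cast
      field_simp
    rw [h1, hft2 lam hlam, Complex.ofReal_div, hRc]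
    field_simp
    rw [hΔdef]
    ring

end
end
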